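/- arXiv:1303.0662 — 2 statements merged into one kernel-verified Lean document; each statement's English description precedes it below -/
import Mathlib

section
/- Let k be a field, V a finite-dimensional k-vector space, and N : V → V a nilpotent k-linear endomorphism. Then there exists a unique increasing filtration (M_i)_{i ∈ ℤ} of V by k-subspaces such that: M_i = 0 for all sufficiently small i, M_i = V for all sufficiently large i, N(M_i) ⊆ M_{i−2} for every i ∈ ℤ, and for every integer j ≥ 0 the map N^j induces an isomorphism gr^M_j V → gr^M_{−j} V, where gr^M_i V := M_i / M_{i−1} and the induced map comes from N^j(M_j) ⊆ M_{−j} and N^j(M_{j−1}) ⊆ M_{−j−1}. -/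
/-!
Statement 5: For a nilpotent endomorphism `N` of a finite-dimensional vector space `V`
over a field `k`, there exists a unique increasing filtration `(M_i)_{i ∈ ℤ}` of `V`
(the monodromy filtration) with `M_i = 0` for `i ≪ 0`, `M_i = V` for `i ≫ 0`,
`N (M_i) ⊆ M_{i−2}`, and such that for every `j ≥ 0` the map `N^j` induces an
isomorphism `gr^M_j V ≅ gr^M_{−j} V`.
-/

/-- The map `gr_p V → gr_q V` (quotients of submodules `p/p'` and `q/q'`) induced by a
linear map `f` with `f p ⊆ q` and `f p' ⊆ q'`. -/
noncomputable def inducedGr {k V : Type*} [Field k] [AddCommGroup V] [Module k V]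
    (f : V →ₗ[k] V) (p p' q q' : Submodule k V)
    (hpq : ∀ x ∈ p, f x ∈ q) (hp' : p' ≤ p) (hq' : q' ≤ q)
    (h2 : ∀ x ∈ p', f x ∈ q') :
    (p ⧸ p'.comap p.subtype) →ₗ[k] (q ⧸ q'.comap q.subtype) :=
  Submodule.mapQ (p'.comap p.subtype) (q'.comap q.subtype) (f.restrict hpq)
    (by
      intro x hx
      simp only [Submodule.mem_comap, LinearMap.restrict_apply] at hx ⊢
      exact h2 _ hx)

/-- `M` is the monodromy filtration of the nilpotent endomorphism `N`:
an increasing filtration, exhaustive and separated (eventually `⊥` below and `⊤` above),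
satisfying `N (M i) ⊆ M (i-2)`, such that for every `j ≥ 0`, `N^j` induces an isomorphism
`gr^M_j = M j / M (j-1) ≅ gr^M_{-j} = M (-j) / M (-j-1)`. -/
def IsMonodromyFiltration {k V : Type*} [Field k] [AddCommGroup V] [Module k V]
    (N : V →ₗ[k] V) (M : ℤ → Submodule k V) : Prop :=
  Monotone M ∧
  (∃ a : ℤ, ∀ i ≤ a, M i = ⊥) ∧
  (∃ b : ℤ, ∀ i : ℤ, b ≤ i → M i = ⊤) ∧
  (∀ i : ℤ, ∀ x ∈ M i, N x ∈ M (i - 2)) ∧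
  (∀ (j : ℕ)
    (h1 : ∀ x ∈ M (j : ℤ), (N ^ j) x ∈ M (-(j : ℤ)))
    (h2 : ∀ x ∈ M ((j : ℤ) - 1), (N ^ j) x ∈ M (-(j : ℤ) - 1))
    (hp : M ((j : ℤ) - 1) ≤ M (j : ℤ)) (hq : M (-(j : ℤ) - 1) ≤ M (-(j : ℤ))),
    Function.Bijective
      (inducedGr (N ^ j) (M (j : ℤ)) (M ((j : ℤ) - 1)) (M (-(j : ℤ))) (M (-(j : ℤ) - 1))
        h1 hp hq h2))

theorem mono_desc (P : ℕ → Prop) (T : ℕ) (hT : ∀ t, T ≤ t → P t)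
    (hs : ∀ t, P (t + 1) → P t) (t : ℕ) : P t := by
  have key : ∀ s t, T ≤ t + s → P t := by
    intro s
    induction s with
    | zero => intro t h; exact hT t h
    | succ s ih => intro t h; exact hs t (ih (t + 1) (by omega))
  exact key T t (by omega)

theorem inducedGr_bij_iff {k V : Type*} [Field k] [AddCommGroup V] [Module k V]
    (f : V →ₗ[k] V) (p p' q q' : Submodule k V)
    (hpq : ∀ x ∈ p, f x ∈ q) (hp' : p' ≤ p) (hq' : q' ≤ q)
    (h2 : ∀ x ∈ p', f x ∈ q') :
    Function.Bijective (inducedGr f p p' q q' hpq hp' hq' h2) ↔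
      (∀ x ∈ p, f x ∈ q' → x ∈ p') ∧ (∀ y ∈ q, ∃ x ∈ p, f x - y ∈ q') := by
  unfold Function.Bijective
  apply and_congr
  · rw [← LinearMap.ker_eq_bot, LinearMap.ker_eq_bot']
    constructor
    · intro h x hx hfx
      have := h (Submodule.Quotient.mk ⟨x, hx⟩) (by
        rw [inducedGr, Submodule.mapQ_apply, Submodule.Quotient.mk_eq_zero]
        exact hfx)
      rw [Submodule.Quotient.mk_eq_zero] at this
      exact this
    · intro h m hm
      obtain ⟨⟨x, hx⟩, rfl⟩ := Submodule.Quotient.mk_surjective _ m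
      rw [inducedGr, Submodule.mapQ_apply, Submodule.Quotient.mk_eq_zero] at hm
      rw [Submodule.Quotient.mk_eq_zero]
      exact h x hx hm
  · constructor
    · intro h y hy
      obtain ⟨m, hm⟩ := h (Submodule.Quotient.mk ⟨y, hy⟩)
      obtain ⟨⟨x, hx⟩, rfl⟩ := Submodule.Quotient.mk_surjective _ m
      rw [inducedGr, Submodule.mapQ_apply, Submodule.Quotient.eq] at hm
      exact ⟨x, hx, hm⟩
    · intro h m
      obtain ⟨⟨y, hy⟩, rfl⟩ := Submodule.Quotient.mk_surjective _ m
      obtain ⟨x, hx, hxy⟩ := h y hy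
      refine ⟨Submodule.Quotient.mk ⟨x, hx⟩, ?_⟩
      rw [inducedGr, Submodule.mapQ_apply, Submodule.Quotient.eq]
      exact hxy

section
variable {k V : Type*} [Field k] [AddCommGroup V] [Module k V]

theorem mono_pow_mem {N : V →ₗ[k] V} {M : ℤ → Submodule k V}
    (h : ∀ i : ℤ, ∀ x ∈ M i, N x ∈ M (i - 2)) (j : ℕ) :
    ∀ i : ℤ, ∀ x ∈ M i, (N ^ j) x ∈ M (i - 2 * j) := by
  induction j with
  | zero => intro i x hx; simpa using hx
  | succ j ih =>
    intro i x hx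
    rw [pow_succ', Module.End.mul_apply]
    have := h _ _ (ih i x hx)
    convert this using 2
    push_cast; ring

theorem mono_inj {N : V →ₗ[k] V} {M : ℤ → Submodule k V} (h : IsMonodromyFiltration N M)
    (j : ℕ) : (∀ x ∈ M (j : ℤ), (N ^ j) x ∈ M (-(j : ℤ) - 1) → x ∈ M ((j : ℤ) - 1)) ∧
      (∀ y ∈ M (-(j : ℤ)), ∃ x ∈ M (j : ℤ), (N ^ j) x - y ∈ M (-(j : ℤ) - 1)) := by
  obtain ⟨hm, -, -, hN, hb⟩ := h
  have h1 : ∀ x ∈ M (j : ℤ), (N ^ j) x ∈ M (-(j : ℤ)) :=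
    fun x hx => hm (by omega) (mono_pow_mem hN j _ x hx)
  have h2 : ∀ x ∈ M ((j : ℤ) - 1), (N ^ j) x ∈ M (-(j : ℤ) - 1) :=
    fun x hx => hm (by omega) (mono_pow_mem hN j _ x hx)
  exact (inducedGr_bij_iff _ _ _ _ _ h1 _ _ h2).1
    (hb j h1 h2 (hm (by omega)) (hm (by omega)))

theorem mono_ker {N : V →ₗ[k] V} {M : ℤ → Submodule k V} (h : IsMonodromyFiltration N M)
    (j : ℕ) (x : V) (hx : (N ^ j) x = 0) : x ∈ M ((j : ℤ) - 1) := by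
  obtain ⟨b, hb⟩ := h.2.2.1
  have := mono_desc (fun t => x ∈ M ((j : ℤ) - 1 + t)) (b - j + 1).toNat
    (by intro t ht
        show x ∈ M _
        rw [hb _ (by omega)]; trivial)
    (by intro t ht
        have h1 := (mono_inj h (j + t)).1 x (by
          convert ht using 2; push_cast; ring) (by
          rw [add_comm, pow_add, Module.End.mul_apply, hx, map_zero]; exact zero_mem _)
        show x ∈ M _
        convert h1 using 2; push_cast; ring) 0
  simpa using this

theorem mono_surj {N : V →ₗ[k] V} {M : ℤ → Submodule k V} (h : IsMonodromyFiltration N M)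
    (c : ℕ) (y : V) (hy : y ∈ M (-(c : ℤ))) : ∃ x ∈ M (c : ℤ), (N ^ c) x = y := by
  obtain ⟨a, ha⟩ := h.2.1
  have := mono_desc (fun t => ∀ y ∈ M (-(c : ℤ) - t), ∃ x ∈ M (c : ℤ), (N ^ c) x = y)
    (-a).toNat
    (by intro t ht y hy
        rw [ha _ (by omega)] at hy
        exact ⟨0, zero_mem _, by rw [map_zero]; exact ((Submodule.mem_bot k).1 hy).symm⟩)
    (by intro t ih y hy
        obtain ⟨x, hx, hxy⟩ := (mono_inj h (c + t)).2 y (h.1 (by push_cast; omega) hy)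
        obtain ⟨z, hz, hzy⟩ := ih _ (h.1 (by push_cast; omega) hxy)
        refine ⟨(N ^ t) x - z, sub_mem
          (h.1 (by push_cast; omega) (mono_pow_mem h.2.2.2.1 t _ x hx)) hz, ?_⟩
        rw [map_sub, hzy, ← Module.End.mul_apply, ← pow_add]; abel) 0
  exact this y (by simpa using hy)

theorem mono_le {N : V →ₗ[k] V} {M M' : ℤ → Submodule k V} (h : IsMonodromyFiltration N M)
    (h' : IsMonodromyFiltration N M') : M ≤ M' := by
  obtain ⟨b, hb⟩ := h'.2.2.1
  have hpos : ∀ i : ℕ, M (i : ℤ) ≤ M' (i : ℤ) ∧ M ((i + 1 : ℕ) : ℤ) ≤ M' ((i + 1 : ℕ) : ℤ) := by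
    refine mono_desc _ b.toNat ?_ ?_
    · intro t ht
      rw [hb _ (by omega), hb _ (by omega)]
      exact ⟨le_top, le_top⟩
    · rintro i ⟨h1, h2⟩
      refine ⟨?_, h1⟩
      intro x hx
      have e1 := mono_pow_mem h.2.2.2.1 (i + 1) _ x hx
      obtain ⟨z, hz, hzx⟩ := mono_surj h (i + 1 + 1) _ (h.1 (by push_cast; omega) e1)
      have e2 : x - N z ∈ M' (i : ℤ) := by
        have := mono_ker h' (i + 1) (x - N z) (by
          rw [map_sub, ← hzx, pow_succ N (i + 1), Module.End.mul_apply, sub_self])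
        convert this using 2; push_cast; ring
      have e3 : N z ∈ M' (i : ℤ) := by
        have := h'.2.2.2.1 _ _ (h2 hz)
        convert this using 2; push_cast; ring
      simpa using add_mem e2 e3
  intro i
  obtain ⟨c, rfl | rfl⟩ := i.eq_nat_or_neg
  · exact (hpos c).1
  · intro y hy
    obtain ⟨x, hx, rfl⟩ := mono_surj h c y hy
    exact h'.1 (by omega) (mono_pow_mem h'.2.2.2.1 c _ x ((hpos c).1 hx))

/-- Explicit monodromy filtration. -/
def monoFil (N : V →ₗ[k] V) (i : ℤ) : Submodule k V :=
  ⨆ m : ℕ, (LinearMap.ker (N ^ (i + 2 * m + 1).toNat)).map (N ^ m)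

theorem monoFil_mem {N : V →ₗ[k] V} {i : ℤ} (m r : ℕ) (u : V) (hu : (N ^ r) u = 0)
    (hr : (r : ℤ) ≤ i + 2 * m + 1) : (N ^ m) u ∈ monoFil N i := by
  refine Submodule.mem_iSup_of_mem m ⟨u, ?_, rfl⟩
  obtain ⟨s, hs⟩ := Nat.exists_eq_add_of_le (show r ≤ (i + 2 * m + 1).toNat by omega)
  show (N ^ _) u = 0
  rw [hs, add_comm, pow_add, Module.End.mul_apply, hu, map_zero]

theorem monoFil_le {N : V →ₗ[k] V} {i : ℤ} {W : Submodule k V}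
    (h : ∀ (m r : ℕ) (u : V), (N ^ r) u = 0 → (r : ℤ) = i + 2 * m + 1 → m < r → (N ^ m) u ∈ W) :
    monoFil N i ≤ W := by
  refine iSup_le fun m => ?_
  rintro _ ⟨u, hu, rfl⟩
  have hu : (N ^ (i + 2 * m + 1).toNat) u = 0 := hu
  by_cases hlt : m < (i + 2 * m + 1).toNat
  · exact h m _ u hu (by omega) hlt
  · obtain ⟨s, hs⟩ := Nat.exists_eq_add_of_le (not_lt.1 hlt)
    have : (N ^ m) u = 0 := by
      rw [hs, add_comm, pow_add, Module.End.mul_apply, hu, map_zero]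
    rw [this]; exact zero_mem _

theorem monoFil_surj {N : V →ₗ[k] V} (j : ℕ) (y : V) (hy : y ∈ monoFil N (-(j : ℤ))) :
    ∃ x ∈ monoFil N (j : ℤ), (N ^ j) x = y := by
  have : monoFil N (-(j : ℤ)) ≤ (monoFil N (j : ℤ)).map (N ^ j) := by
    refine monoFil_le fun m r u hu hr hlt => ?_
    obtain ⟨s, rfl⟩ := Nat.exists_eq_add_of_le (show j ≤ m by omega)
    refine ⟨(N ^ s) u, monoFil_mem s r u hu (by push_cast at hr; omega), ?_⟩
    rw [pow_add, Module.End.mul_apply]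
  exact this hy

theorem monoFil_is (N : V →ₗ[k] V) (hN : IsNilpotent N) :
    IsMonodromyFiltration N (monoFil N) := by
  obtain ⟨n, hn⟩ := hN
  have hz : ∀ m, n ≤ m → N ^ m = 0 := fun m hm => pow_eq_zero_of_le hm hn
  have hstep : ∀ i : ℤ, ∀ x ∈ monoFil N i, N x ∈ monoFil N (i - 2) := by
    intro i
    have : monoFil N i ≤ (monoFil N (i - 2)).comap N := by
      refine monoFil_le fun m r u hu hr hlt => ?_
      show N ((N ^ m) u) ∈ monoFil N (i - 2)
      rw [← Module.End.mul_apply, ← pow_succ']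
      exact monoFil_mem (m + 1) r u hu (by push_cast; omega)
    exact this
  refine ⟨?_, ⟨-n, ?_⟩, ⟨n, ?_⟩, hstep, ?_⟩
  · intro i i' hi
    exact monoFil_le fun m r u hu hr hlt => monoFil_mem m r u hu (by omega)
  · intro i hi
    refine le_bot_iff.1 (monoFil_le fun m r u hu hr hlt => ?_)
    rw [hz m (by omega)]; exact zero_mem _
  · intro i hi
    refine top_le_iff.1 fun x _ => ?_
    have := monoFil_mem (N := N) (i := i) 0 n x (by rw [hn]; rfl) (by push_cast; omega)
    simpa using this
  · intro j h1 h2 hp hq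
    rw [inducedGr_bij_iff]
    refine ⟨?_, ?_⟩
    · intro x hx hxj
      obtain ⟨z, hz, hzx⟩ := monoFil_surj (N := N) (j + 1) _ (by
        convert hxj using 2; push_cast; ring)
      have e2 : x - N z ∈ monoFil N ((j : ℤ) - 1) := by
        have := monoFil_mem (N := N) (i := (j : ℤ) - 1) 0 j (x - N z) (by
          rw [map_sub, ← hzx, pow_succ, Module.End.mul_apply, sub_self]) (by push_cast; omega)
        simpa using this
      have e3 : N z ∈ monoFil N ((j : ℤ) - 1) := by
        have := hstep _ _ hz
        convert this using 2; push_cast; ring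
      simpa using add_mem e2 e3
    · intro y hy
      obtain ⟨x, hx, rfl⟩ := monoFil_surj j y hy
      exact ⟨x, hx, by simp⟩

end

theorem stmt_5 {k V : Type*} [Field k] [AddCommGroup V] [Module k V]
    [FiniteDimensional k V] (N : V →ₗ[k] V) (hN : IsNilpotent N) :
    ∃! M : ℤ → Submodule k V, IsMonodromyFiltration N M := by
  exact ⟨monoFil N, monoFil_is N hN, fun M hM =>
    le_antisymm (mono_le hM (monoFil_is N hN)) (mono_le (monoFil_is N hN) hM)⟩
end

section
/- Let k be a field of characteristic zero, let V' and V'' be finite-dimensional k-vector spaces equipped with nilpotent endomorphisms N' and N'', and let N := N' ⊗ id + id ⊗ N'' be the induced (nilpotent) endomorphism of V' ⊗_k V''. Then the monodromy filtration of (V' ⊗_k V'', N) is given for every i ∈ ℤ by M_i(V' ⊗ V'') = Σ_{i' + i'' = i} M_{i'}(V', N') ⊗ M_{i''}(V'', N'') (the sum over all i', i'' with i' + i'' = i of the images of M_{i'}(V') ⊗_k M_{i''}(V'') in V' ⊗_k V''); consequently gr^M_i(V' ⊗ V'') ≅ ⊕_{i' + i'' = i} gr^M_{i'}(V') ⊗_k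 gr^M_{i''}(V'') for every i ∈ ℤ. -/
open TensorProduct DirectSum

/-- The `i`-th graded piece `M i / M (i-1)` of a `ℤ`-indexed filtration by submodules. -/
abbrev grQ {k V : Type*} [Field k] [AddCommGroup V] [Module k V]
    (M : ℤ → Submodule k V) (i : ℤ) :=
  M i ⧸ ((M (i - 1)).comap (M i).subtype)


/-- `(H, X, Y)` is an `sl₂`-triple with `H` diagonalizable with integer weights. -/
structure WtTriple {k V : Type*} [Field k] [AddCommGroup V] [Module k V]
    (H X Y : V →ₗ[k] V) : Prop where
  hHY : ∀ v, H (Y v) = Y (H v) - (2 : k) • Y v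
  hHX : ∀ v, H (X v) = X (H v) + (2 : k) • X v
  hXY : ∀ v, X (Y v) = Y (X v) + H v
  top : ⨆ l : ℤ, Module.End.eigenspace H (l : k) = ⊤

section triple
variable {k V : Type*} [Field k] [AddCommGroup V] [Module k V] {H X Y : V →ₗ[k] V}

theorem WtTriple.symm (h : WtTriple H X Y) : WtTriple (-H) Y X where
  hHY v := by simp [h.hHX v]; abel
  hHX v := by simp [h.hHY v]; abel
  hXY v := by simp [h.hXY v]
  top := by
    rw [eq_top_iff, ← h.top]
    refine iSup_le fun l => le_trans ?_ (le_iSup _ (-l))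
    intro x hx
    rw [Module.End.mem_eigenspace_iff] at hx ⊢
    simp [hx]

theorem WtTriple.Y_mem (h : WtTriple H X Y) {l : ℤ} {v : V}
    (hv : v ∈ Module.End.eigenspace H (l : k)) :
    Y v ∈ Module.End.eigenspace H ((l - 2 : ℤ) : k) := by
  rw [Module.End.mem_eigenspace_iff] at hv ⊢
  rw [h.hHY, hv, map_smul, ← sub_smul]; push_cast; rfl

theorem WtTriple.X_mem (h : WtTriple H X Y) {l : ℤ} {v : V}
    (hv : v ∈ Module.End.eigenspace H (l : k)) :
    X v ∈ Module.End.eigenspace H ((l + 2 : ℤ) : k) := by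
  rw [Module.End.mem_eigenspace_iff] at hv ⊢
  rw [h.hHX, hv, map_smul, ← add_smul]; push_cast; rfl

theorem WtTriple.Ypow_mem (h : WtTriple H X Y) {l : ℤ} {v : V}
    (hv : v ∈ Module.End.eigenspace H (l : k)) (s : ℕ) :
    (Y ^ s) v ∈ Module.End.eigenspace H ((l - 2 * s : ℤ) : k) := by
  induction s with
  | zero => simpa using hv
  | succ s ih =>
    rw [pow_succ', Module.End.mul_apply]
    have := h.Y_mem ih
    convert this using 3
    push_cast; ring

theorem WtTriple.Xpow_mem (h : WtTriple H X Y) {l : ℤ} {v : V}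
    (hv : v ∈ Module.End.eigenspace H (l : k)) (s : ℕ) :
    (X ^ s) v ∈ Module.End.eigenspace H ((l + 2 * s : ℤ) : k) := by
  induction s with
  | zero => simpa using hv
  | succ s ih =>
    rw [pow_succ', Module.End.mul_apply]
    have := h.X_mem ih
    convert this using 3
    push_cast; ring

theorem WtTriple.comm_pow (h : WtTriple H X Y) {l : ℤ} {v : V}
    (hv : v ∈ Module.End.eigenspace H (l : k)) (s : ℕ) :
    X ((Y ^ (s + 1)) v) = (Y ^ (s + 1)) (X v) + (((s + 1) * (l - s) : ℤ) : k) • (Y ^ s) v := by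
  induction s with
  | zero =>
    rw [Module.End.mem_eigenspace_iff] at hv
    simp [h.hXY, hv]
  | succ s ih =>
    have h1 := h.Ypow_mem hv (s + 1)
    rw [Module.End.mem_eigenspace_iff] at h1
    rw [pow_succ' Y (s + 1), Module.End.mul_apply, h.hXY, ih, h1, map_add, map_smul,
      Module.End.mul_apply, ← Module.End.mul_apply Y (Y ^ s) v, ← pow_succ', add_assoc, ← add_smul]
    congr 2
    push_cast; ring

theorem WtTriple.neg_eig {H : V →ₗ[k] V} (l : ℤ) :
    Module.End.eigenspace (-H) (l : k) = Module.End.eigenspace H ((-l : ℤ) : k) := by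
  ext x
  rw [Module.End.mem_eigenspace_iff, Module.End.mem_eigenspace_iff]
  simp [neg_eq_iff_eq_neg]

variable [CharZero k]

theorem WtTriple.eq_zero_aux (h : WtTriple H X Y) (m : ℕ) :
    ∀ (l : ℤ) (s : ℕ) (v : V), v ∈ Module.End.eigenspace H (l : k) → (s : ℤ) ≤ l →
      (X ^ m) v = 0 → (Y ^ s) v = 0 → v = 0 := by
  induction m with
  | zero => intro l s v _ _ h1 _; simpa using h1
  | succ m ih =>
    intro l s
    induction s with
    | zero => intro v _ _ _ h1; simpa using h1
    | succ s ihs =>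
      intro v hv hs hX hY
      have hc := h.comm_pow hv s
      have hXv : X v = 0 := by
        refine ih (l + 2) (s + 2) (X v) (h.X_mem hv) (by push_cast at *; linarith) ?_ ?_
        · rw [← Module.End.mul_apply, ← pow_succ, hX]
        · have hc' := congrArg Y hc
          rw [hY] at hc'
          rw [map_add, map_smul, ← Module.End.mul_apply Y (Y ^ s) v, ← pow_succ', hY,
            ← Module.End.mul_apply Y (Y ^ (s + 1)), ← pow_succ'] at hc'
          simpa using hc'.symm
      rw [hY, hXv] at hc
      simp only [map_zero, zero_add] at hc
      have hne : (((s + 1) * (l - s) : ℤ) : k) ≠ 0 := by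
        rw [Int.cast_ne_zero]
        push_cast at hs
        exact mul_ne_zero (by positivity) (by linarith)
      exact ihs v hv (by push_cast at hs; linarith) hX
        ((smul_eq_zero.mp hc.symm).resolve_left hne)

variable [FiniteDimensional k V]

theorem wt_bounded (H : V →ₗ[k] V) :
    ∃ B : ℤ, 0 ≤ B ∧ ∀ l : ℤ, B < |l| → Module.End.eigenspace H (l : k) = ⊥ := by
  have hf : Set.Finite ((fun l : ℤ => (l : k)) ⁻¹' {μ | Module.End.HasEigenvalue H μ}) :=
    (Module.End.finite_hasEigenvalue H).preimage (Int.cast_injective.injOn)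
  obtain ⟨B, hB⟩ := (hf.image (fun l => |l|)).bddAbove
  refine ⟨max B 0, le_max_right _ _, fun l hl => ?_⟩
  by_contra hne
  have : |l| ≤ B := hB ⟨l, hne, rfl⟩
  exact absurd (lt_of_le_of_lt (le_max_left B 0) hl) (not_lt.mpr this)

theorem WtTriple.Y_inj (h : WtTriple H X Y) {j : ℕ} {v : V}
    (hv : v ∈ Module.End.eigenspace H ((j : ℤ) : k)) (h0 : (Y ^ j) v = 0) : v = 0 := by
  obtain ⟨B, hB0, hB⟩ := wt_bounded H
  refine h.eq_zero_aux (B.toNat + 1) j j v hv le_rfl ?_ h0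
  have := h.Xpow_mem hv (B.toNat + 1)
  rw [hB] at this
  · simpa using this
  · rw [abs_of_nonneg (by positivity)]
    push_cast
    rw [Int.toNat_of_nonneg hB0]
    have : (0 : ℤ) ≤ j := by positivity
    linarith

theorem WtTriple.Y_surj (h : WtTriple H X Y) {j : ℕ} {w : V}
    (hw : w ∈ Module.End.eigenspace H ((-(j : ℤ) : ℤ) : k)) :
    ∃ v ∈ Module.End.eigenspace H ((j : ℤ) : k), (Y ^ j) v = w := by
  set E := Module.End.eigenspace H ((j : ℤ) : k)
  set E' := Module.End.eigenspace H ((-(j : ℤ) : ℤ) : k)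
  have hf : ∀ v ∈ E, (Y ^ j) v ∈ E' := fun v hv => by
    have := h.Ypow_mem hv j
    rwa [show (j : ℤ) - 2 * j = -j by ring] at this
  have hg : ∀ v ∈ E', (X ^ j) v ∈ E := fun v hv => by
    have := h.Xpow_mem hv j
    rwa [show -(j : ℤ) + 2 * j = j by ring] at this
  have fi : Function.Injective ((Y ^ j).restrict hf) := by
    rw [injective_iff_map_eq_zero]
    intro a ha
    exact Subtype.ext (h.Y_inj a.2 (congrArg Subtype.val ha))
  have gi : Function.Injective ((X ^ j).restrict hg) := by
    rw [injective_iff_map_eq_zero]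
    intro a ha
    refine Subtype.ext (h.symm.Y_inj (j := j) ?_ (congrArg Subtype.val ha))
    rw [WtTriple.neg_eig]
    exact a.2
  have hd : Module.finrank k E = Module.finrank k E' :=
    le_antisymm (LinearMap.finrank_le_finrank_of_injective fi)
      (LinearMap.finrank_le_finrank_of_injective gi)
  obtain ⟨v, hv⟩ := (LinearMap.injective_iff_surjective_of_finrank_eq_finrank hd).mp fi ⟨w, hw⟩
  exact ⟨v, v.2, congrArg Subtype.val hv⟩

end triple

/-- The filtration attached to the weight grading of `H`. -/
def wtFil {k V : Type*} [Field k] [AddCommGroup V] [Module k V] (H : V →ₗ[k] V) (i : ℤ) :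
    Submodule k V := ⨆ l : ℤ, ⨆ _ : l ≤ i, Module.End.eigenspace H (l : k)

section fil
variable {k V : Type*} [Field k] [AddCommGroup V] [Module k V] {H X Y : V →ₗ[k] V}

theorem wtFil_mono (H : V →ₗ[k] V) : Monotone (wtFil H) := fun _ _ hij =>
  iSup_mono fun _ => iSup_le fun hl => le_iSup_of_le (hl.trans hij) le_rfl

theorem wt_le_wtFil (H : V →ₗ[k] V) {l i : ℤ} (h : l ≤ i) :
    Module.End.eigenspace H (l : k) ≤ wtFil H i :=
  le_iSup_of_le l (le_iSup_of_le h le_rfl)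

theorem wtFil_eq_sup (H : V →ₗ[k] V) (i : ℤ) :
    wtFil H i = Module.End.eigenspace H (i : k) ⊔ wtFil H (i - 1) := by
  apply le_antisymm
  · refine iSup_le fun l => iSup_le fun hl => ?_
    rcases eq_or_lt_of_le hl with rfl | hl
    · exact le_sup_left
    · exact le_sup_of_le_right (wt_le_wtFil H (by omega))
  · exact sup_le (wt_le_wtFil H le_rfl) (wtFil_mono H (by omega))

theorem wt_indep [CharZero k] (H : V →ₗ[k] V) :
    iSupIndep fun l : ℤ => Module.End.eigenspace H (l : k) :=
  (Module.End.eigenspaces_iSupIndep H).comp Int.cast_injective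

theorem wt_disj [CharZero k] (H : V →ₗ[k] V) (i : ℤ) :
    Disjoint (Module.End.eigenspace H (i : k)) (wtFil H (i - 1)) :=
  (wt_indep H i).mono_right <| iSup_le fun l => iSup_le fun hl =>
    le_iSup_of_le l (le_iSup_of_le (by omega) le_rfl)

theorem WtTriple.fil_mem (h : WtTriple H X Y) {i : ℤ} {x : V} (hx : x ∈ wtFil H i) :
    Y x ∈ wtFil H (i - 2) := by
  have : wtFil H i ≤ (wtFil H (i - 2)).comap Y := by
    refine iSup_le fun l => iSup_le fun hl => ?_
    intro y hy
    exact wt_le_wtFil H (by omega) (h.Y_mem hy)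
  exact this hx

theorem WtTriple.isMono [CharZero k] [FiniteDimensional k V] (h : WtTriple H X Y) :
    IsMonodromyFiltration Y (wtFil H) := by
  obtain ⟨B, hB0, hB⟩ := wt_bounded H
  refine ⟨wtFil_mono H, ⟨-B - 1, fun i hi => ?_⟩, ⟨B, fun i hi => ?_⟩,
    fun i x hx => h.fil_mem hx, ?_⟩
  · rw [eq_bot_iff]
    refine iSup_le fun l => iSup_le fun hl => ?_
    rw [hB l (by rw [lt_abs]; right; linarith)]
  · rw [eq_top_iff, ← h.top]
    refine iSup_le fun l => ?_
    by_cases hl : l ≤ i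
    · exact wt_le_wtFil H hl
    · rw [hB l (by rw [lt_abs]; left; linarith)]
      exact bot_le
  · intro j h1 h2 hp hq
    constructor
    · rw [injective_iff_map_eq_zero]
      intro a
      obtain ⟨⟨x, hx⟩, rfl⟩ := Submodule.Quotient.mk_surjective _ a
      intro ha
      have ha' : (Y ^ j) x ∈ wtFil H (-(j : ℤ) - 1) := 
        (Submodule.Quotient.mk_eq_zero ((wtFil H (-(j : ℤ) - 1)).comap (wtFil H (-(j : ℤ))).subtype)
          (x := (⟨(Y ^ j) x, h1 x hx⟩ : wtFil H (-(j : ℤ))))).mp ha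
      refine (Submodule.Quotient.mk_eq_zero _).mpr ?_
      change x ∈ wtFil H ((j : ℤ) - 1)
      have hx' := hx
      rw [wtFil_eq_sup] at hx'
      obtain ⟨e, he, y, hy, rfl⟩ := Submodule.mem_sup.mp hx'
      have he2 : (Y ^ j) e ∈ wtFil H (-(j : ℤ) - 1) := by
        rw [map_add] at ha'
        exact (Submodule.add_mem_iff_left _ (h2 y hy)).mp ha'
      have he3 := h.Ypow_mem he j
      rw [show (j : ℤ) - 2 * j = -j by ring] at he3
      have := Submodule.disjoint_def.mp (wt_disj H (-(j : ℤ))) _ he3 he2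
      rw [h.Y_inj he this, zero_add]
      exact hy
    · intro b
      obtain ⟨⟨w, hw⟩, rfl⟩ := Submodule.Quotient.mk_surjective _ b
      have hw' := hw
      rw [wtFil_eq_sup] at hw'
      obtain ⟨e, he, y, hy, rfl⟩ := Submodule.mem_sup.mp hw'
      obtain ⟨v, hv, rfl⟩ := h.Y_surj he
      refine ⟨Submodule.Quotient.mk ⟨v, wt_le_wtFil H le_rfl hv⟩, ?_⟩
      refine (Submodule.Quotient.eq _).mpr ?_
      change (Y ^ j) v - ((Y ^ j) v + y) ∈ wtFil H (-(j : ℤ) - 1)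
      simpa using hy

end fil

section uniq
variable {k V : Type*} [Field k] [AddCommGroup V] [Module k V] {N : V →ₗ[k] V}
  {M : ℤ → Submodule k V}

theorem IsMonodromyFiltration.pow_mem (h : IsMonodromyFiltration N M) {i : ℤ} {x : V}
    (hx : x ∈ M i) (s : ℕ) : (N ^ s) x ∈ M (i - 2 * s) := by
  induction s with
  | zero => simpa using hx
  | succ s ih =>
    rw [pow_succ', Module.End.mul_apply]
    convert h.2.2.2.1 _ _ ih using 2
    push_cast; ring

theorem IsMonodromyFiltration.bij (h : IsMonodromyFiltration N M) (j : ℕ) :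
    (∀ x ∈ M j, (N ^ j) x ∈ M (-(j : ℤ) - 1) → x ∈ M ((j : ℤ) - 1)) ∧
    (∀ y ∈ M (-(j : ℤ)), ∃ x ∈ M j, y - (N ^ j) x ∈ M (-(j : ℤ) - 1)) := by
  have h1 : ∀ x ∈ M (j : ℤ), (N ^ j) x ∈ M (-(j : ℤ)) := fun x hx => by
    convert h.pow_mem hx j using 2; ring
  have h2 : ∀ x ∈ M ((j : ℤ) - 1), (N ^ j) x ∈ M (-(j : ℤ) - 1) := fun x hx => by
    convert h.pow_mem hx j using 2; ring
  have hb := h.2.2.2.2 j h1 h2 (h.1 (by omega)) (h.1 (by omega))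
  constructor
  · intro x hx hN
    have := (injective_iff_map_eq_zero _).mp hb.1 (Submodule.Quotient.mk ⟨x, hx⟩)
      ((Submodule.Quotient.mk_eq_zero _).mpr hN)
    have h3 := (Submodule.Quotient.mk_eq_zero _).mp this
    exact h3
  · intro y hy
    obtain ⟨a, ha⟩ := hb.2 (Submodule.Quotient.mk ⟨y, hy⟩)
    obtain ⟨⟨x, hx⟩, rfl⟩ := Submodule.Quotient.mk_surjective _ a
    refine ⟨x, hx, ?_⟩
    have h3 := (Submodule.Quotient.eq ((M (-(j : ℤ) - 1)).comap (M (-(j : ℤ))).subtype)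
      (x := ⟨y, hy⟩) (y := ⟨_, h1 x hx⟩)).mp ha.symm
    exact h3

theorem IsMonodromyFiltration.neg_le (h : IsMonodromyFiltration N M) (l : ℕ) :
    ∀ y ∈ M (-(l : ℤ)), ∃ x ∈ M l, (N ^ l) x = y := by
  obtain ⟨a, ha⟩ := h.2.1
  have key : ∀ d l : ℕ, -(l : ℤ) - d ≤ a → ∀ y ∈ M (-(l : ℤ)), ∃ x ∈ M l, (N ^ l) x = y := by
    intro d
    induction d with
    | zero =>
      intro l hl y hy
      rw [ha _ (by simpa using hl)] at hy
      exact ⟨0, zero_mem _, by simpa using hy.symm⟩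
    | succ d ih =>
      intro l hl y hy
      obtain ⟨x, hx, hxy⟩ := (h.bij l).2 y hy
      obtain ⟨z, hz, hzy⟩ := ih (l + 1) (by push_cast at *; linarith) (y - (N ^ l) x) (by
        convert hxy using 2; push_cast; ring)
      refine ⟨x + N z, add_mem hx ?_, ?_⟩
      · have := h.2.2.2.1 _ _ hz
        exact h.1 (by push_cast; omega) this
      · rw [map_add, ← Module.End.mul_apply, ← pow_succ, hzy]; abel
  exact key (-(l : ℤ) - a).toNat l (by have := Int.self_le_toNat (-(l : ℤ) - a); linarith)

theorem IsMonodromyFiltration.ker_le (h : IsMonodromyFiltration N M) (i : ℕ) {x : V}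
    (hx : (N ^ (i + 1)) x = 0) : x ∈ M i := by
  obtain ⟨b, hb⟩ := h.2.2.1
  have key : ∀ d : ℕ, x ∈ M ((i + d : ℕ) : ℤ) → x ∈ M i := by
    intro d
    induction d with
    | zero => exact id
    | succ d ih =>
      intro hd
      apply ih
      have := (h.bij (i + (d + 1))).1 x hd (by
        rw [show i + (d + 1) = d + (i + 1) by ring, pow_add, Module.End.mul_apply, hx, map_zero]
        exact zero_mem _)
      convert this using 2
      push_cast; ring
  apply key b.toNat
  rw [hb _ (by have := Int.self_le_toNat b; push_cast; linarith)]
  trivial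

theorem IsMonodromyFiltration.mem_iff (h : IsMonodromyFiltration N M) (i : ℕ) (x : V) :
    x ∈ M i ↔ ∃ y ∈ M (i + 2 : ℕ), (N ^ (i + 1)) (x - N y) = 0 := by
  constructor
  · intro hx
    have h1 := h.pow_mem hx (i + 1)
    obtain ⟨y, hy, hxy⟩ := h.neg_le (i + 2) ((N ^ (i + 1)) x) (by
      convert h1 using 2; push_cast; ring)
    refine ⟨y, hy, ?_⟩
    rw [map_sub, ← Module.End.mul_apply, ← pow_succ, hxy, sub_self]
  · rintro ⟨y, hy, hxy⟩
    have h1 := h.ker_le i hxy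
    have h2 := h.2.2.2.1 _ _ hy
    rw [show ((i + 2 : ℕ) : ℤ) - 2 = i by push_cast; ring] at h2
    simpa using add_mem h1 h2

theorem IsMonodromyFiltration.unique {M' : ℤ → Submodule k V} (h : IsMonodromyFiltration N M)
    (h' : IsMonodromyFiltration N M') : M = M' := by
  have hnn : ∀ i : ℕ, M i = M' i := by
    obtain ⟨b, hb⟩ := h.2.2.1
    obtain ⟨b', hb'⟩ := h'.2.2.1
    have key : ∀ d i : ℕ, b ≤ i + d → b' ≤ i + d → M i = M' i := by
      intro d
      induction d using Nat.strong_induction_on with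
      | _ d ih =>
        intro i h1 h2
        rcases Nat.eq_zero_or_pos d with rfl | hd
        · rw [hb _ (by simpa using h1), hb' _ (by simpa using h2)]
        · ext x
          rw [h.mem_iff, h'.mem_iff, ih (d - 1) (by omega) (i + 2) (by omega) (by omega)]
    intro i
    exact key (b.toNat + b'.toNat) i (by omega) (by omega)
  funext i
  obtain ⟨n, rfl | rfl⟩ := i.eq_nat_or_neg
  · exact hnn n
  · ext y
    constructor
    · intro hy
      obtain ⟨x, hx, rfl⟩ := h.neg_le n y hy
      rw [hnn] at hx
      convert h'.pow_mem hx n using 2; ring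
    · intro hy
      obtain ⟨x, hx, rfl⟩ := h'.neg_le n y hy
      rw [← hnn] at hx
      convert h.pow_mem hx n using 2; ring

end uniq

section exist
open Polynomial

/-- Existence of a weight triple. -/
def HasTriple {k V : Type*} [Field k] [AddCommGroup V] [Module k V] (Y : V →ₗ[k] V) : Prop :=
  ∃ H X : V →ₗ[k] V, WtTriple H X Y

variable {k V W : Type*} [Field k] [AddCommGroup V] [Module k V] [AddCommGroup W] [Module k W]

/-- Images of weight spaces under an equivariant map. -/
theorem wt_map_le (f : V →ₗ[k] W) (H : V →ₗ[k] V) (H' : W →ₗ[k] W)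
    (hf : ∀ v, H' (f v) = f (H v)) (ht : ⨆ l : ℤ, Module.End.eigenspace H (l : k) = ⊤) (v : V) :
    f v ∈ ⨆ l : ℤ, Module.End.eigenspace H' (l : k) := by
  have : (⊤ : Submodule k V) ≤ (⨆ l : ℤ, Module.End.eigenspace H' (l : k)).comap f := by
    rw [← ht]
    refine iSup_le fun l x hx => ?_
    refine Submodule.mem_iSup_of_mem l ?_
    rw [Module.End.mem_eigenspace_iff] at hx ⊢
    rw [hf, hx, map_smul]
  exact this trivial

theorem HasTriple.of_surj {H X Y : V →ₗ[k] V} (h : WtTriple H X Y) (f : V →ₗ[k] W)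
    (hs : Function.Surjective f) (H' X' Y' : W →ₗ[k] W) (hH : ∀ v, H' (f v) = f (H v))
    (hX : ∀ v, X' (f v) = f (X v)) (hY : ∀ v, Y' (f v) = f (Y v)) : WtTriple H' X' Y' where
  hHY w := by
    obtain ⟨v, rfl⟩ := hs w
    rw [hY, hH, hH, hY, h.hHY, map_sub, map_smul]
  hHX w := by
    obtain ⟨v, rfl⟩ := hs w
    rw [hX, hH, hH, hX, h.hHX, map_add, map_smul]
  hXY w := by
    obtain ⟨v, rfl⟩ := hs w
    rw [hY, hX, hX, hY, hH, h.hXY, map_add]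
  top := by
    rw [eq_top_iff]
    rintro w -
    obtain ⟨v, rfl⟩ := hs w
    exact wt_map_le f H H' hH h.top v

theorem HasTriple.of_equiv {Y : V →ₗ[k] V} (h : HasTriple Y) (f : V ≃ₗ[k] W)
    (Y' : W →ₗ[k] W) (hY : ∀ v, Y' (f v) = f (Y v)) : HasTriple Y' := by
  obtain ⟨H, X, h⟩ := h
  exact ⟨f.toLinearMap ∘ₗ H ∘ₗ f.symm.toLinearMap, f.toLinearMap ∘ₗ X ∘ₗ f.symm.toLinearMap,
    HasTriple.of_surj h f.toLinearMap f.surjective _ _ _ (by simp) (by simp) hY⟩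

theorem HasTriple.directSum {ι : Type*} {U : ι → Type*} [∀ i, AddCommGroup (U i)]
    [∀ i, Module k (U i)] (Y : ∀ i, U i →ₗ[k] U i) (h : ∀ i, HasTriple (Y i)) :
    HasTriple (DirectSum.lmap Y) := by
  classical
  choose H X h using h
  refine ⟨DirectSum.lmap H, DirectSum.lmap X, ?_, ?_, ?_, ?_⟩
  · intro v
    ext i
    simp [(h i).hHY]; rfl
  · intro v
    ext i
    simp [(h i).hHX]; rfl
  · intro v
    ext i
    simp [(h i).hXY]
  · rw [eq_top_iff]
    rintro v -
    induction v using DirectSum.induction_on with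
    | zero => exact zero_mem _
    | of i x =>
      exact wt_map_le (DirectSum.lof k ι U i) (H i) (DirectSum.lmap H) (by simp) (h i).top x
    | add x y hx hy => exact add_mem hx hy

/-- Multiplication by the variable. -/
noncomputable def pY (k : Type*) [Field k] : k[X] →ₗ[k] k[X] := LinearMap.mulLeft k (X : k[X])

/-- The operator `(n-1) - 2 t d/dt`. -/
noncomputable def pH (k : Type*) [Field k] (n : ℕ) : k[X] →ₗ[k] k[X] :=
  ((n : k) - 1) • LinearMap.id - (2 : k) • (pY k ∘ₗ derivative)

/-- The operator `n d/dt - d/dt t d/dt`. -/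
noncomputable def pX (k : Type*) [Field k] (n : ℕ) : k[X] →ₗ[k] k[X] :=
  (n : k) • derivative - derivative ∘ₗ pY k ∘ₗ derivative

theorem p_triple (k : Type*) [Field k] (n : ℕ) : WtTriple (pH k n) (pX k n) (pY k) where
  hHY v := by
    simp only [pH, pX, pY, LinearMap.sub_apply, LinearMap.smul_apply, LinearMap.comp_apply,
      LinearMap.id_apply, LinearMap.mulLeft_apply, derivative_mul, derivative_X, smul_eq_C_mul,
      map_sub, map_add, derivative_C, map_natCast, map_one, map_ofNat]
    ring
  hHX v := by
    simp only [pH, pX, pY, LinearMap.sub_apply, LinearMap.smul_apply, LinearMap.comp_apply,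
      LinearMap.id_apply, LinearMap.mulLeft_apply, derivative_mul, derivative_X, smul_eq_C_mul,
      map_sub, map_add, derivative_C, map_natCast, map_one, map_ofNat, derivative_natCast, derivative_ofNat, derivative_zero,
      derivative_one]
    ring
  hXY v := by
    simp only [pH, pX, pY, LinearMap.sub_apply, LinearMap.smul_apply, LinearMap.comp_apply,
      LinearMap.id_apply, LinearMap.mulLeft_apply, derivative_mul, derivative_X, smul_eq_C_mul,
      map_sub, map_add, derivative_C, map_natCast, map_one, map_ofNat, derivative_natCast, derivative_ofNat, derivative_zero,
      derivative_one]
    ring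
  top := by
    rw [eq_top_iff]
    rintro v -
    induction v using Polynomial.induction_on' with
    | add p q hp hq => exact add_mem hp hq
    | monomial s a =>
      refine Submodule.mem_iSup_of_mem ((n : ℤ) - 1 - 2 * s) ?_
      rw [Module.End.mem_eigenspace_iff]
      simp only [pH, pY, LinearMap.sub_apply, LinearMap.smul_apply, LinearMap.comp_apply,
        LinearMap.id_apply, LinearMap.mulLeft_apply, derivative_monomial]
      rcases s with _ | s
      · simp
      · rw [X_mul_monomial]
        simp only [smul_monomial, Nat.add_sub_cancel, ← map_sub, smul_eq_mul]
        congr 1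
        push_cast; ring

theorem hasTriple_quot (k : Type*) [Field k] (n : ℕ) :
    HasTriple ((DistribSMul.toLinearMap k
      (k[X] ⧸ Submodule.span k[X] {(X : k[X]) ^ n}) (X : k[X]))) := by
  set I := Submodule.span k[X] {(X : k[X]) ^ n} with hI
  set P := I.restrictScalars k with hP
  have hmem : ∀ p, p ∈ P ↔ (X : k[X]) ^ n ∣ p := fun p => by
    rw [hP, Submodule.restrictScalars_mem, hI]
    exact Ideal.mem_span_singleton
  have hdY : ∀ q : k[X], pY k q = X * q := fun q => rfl
  have hd1 : ∀ q : k[X], derivative (X ^ n * q) = (n : k[X]) * X ^ (n - 1) * q + X ^ n * derivative q := by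
    intro q
    simp [derivative_mul, derivative_X_pow]
  have hn1 : (n : k[X]) * (X * X ^ (n - 1)) = (n : k[X]) * X ^ n := by
    rcases n with _ | n
    · simp
    · simp [pow_succ']
  have hnY : ∀ q : k[X], X * derivative (X ^ n * q) = X ^ n * ((n : k[X]) * q + X * derivative q) := by
    intro q
    rw [hd1]; linear_combination q * hn1
  have hYP : P ≤ P.comap (pY k) := fun p hp => by
    rw [Submodule.mem_comap, hmem] at *
    rw [hdY]; exact hp.mul_left _
  have hHP : P ≤ P.comap (pH k n) := fun p hp => by
    rw [Submodule.mem_comap, hmem] at *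
    obtain ⟨q, rfl⟩ := hp
    simp only [pH, LinearMap.sub_apply, LinearMap.smul_apply, LinearMap.comp_apply,
      LinearMap.id_apply, hdY, hnY]
    simp only [smul_eq_C_mul]
    exact dvd_sub ((dvd_mul_right _ _).mul_left _) ((dvd_mul_right _ _).mul_left _)
  have hXP : P ≤ P.comap (pX k n) := fun p hp => by
    rw [Submodule.mem_comap, hmem] at *
    obtain ⟨q, rfl⟩ := hp
    simp only [pX, LinearMap.sub_apply, LinearMap.smul_apply, LinearMap.comp_apply, hdY, hnY]
    rw [hd1 ((n : k[X]) * q + X * derivative q), hd1 q]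
    refine ⟨(n : k[X]) * derivative q - derivative ((n : k[X]) * q + X * derivative q) - (n : k[X]) * derivative q, ?_⟩
    simp only [smul_eq_C_mul, map_natCast]
    linear_combination (-derivative q) * hn1
  have ht : WtTriple (P.mapQ P _ hHP) (P.mapQ P _ hXP) (P.mapQ P _ hYP) :=
    HasTriple.of_surj (p_triple k n) P.mkQ P.mkQ_surjective _ _ _ (fun _ => rfl) (fun _ => rfl)
      (fun _ => rfl)
  refine HasTriple.of_equiv ⟨_, _, ht⟩ (Submodule.Quotient.restrictScalarsEquiv k I) _ ?_
  intro v
  obtain ⟨v, rfl⟩ := P.mkQ_surjective v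
  rfl

theorem hasTriple_of_nilpotent [FiniteDimensional k V] (N : V →ₗ[k] V) (hN : IsNilpotent N) :
    HasTriple N := by
  classical
  obtain ⟨m, hm⟩ := hN
  have htor : Module.IsTorsion k[X] (Module.AEval' N) :=
    Module.AEval.isTorsion_of_finiteDimensional k V N
  obtain ⟨ι, _, p, hp, e, ⟨φ⟩⟩ := Module.equiv_directSum_of_isTorsion htor
  have hspan : ∀ i, Submodule.span k[X] {p i ^ e i} = Submodule.span k[X] {(X : k[X]) ^ e i} := by
    intro i
    rcases Nat.eq_zero_or_pos (e i) with h0 | h0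
    · rw [h0]; simp
    have hkill : ∀ z : Module.AEval' N, (X : k[X]) ^ m • z = 0 := by
      intro z
      obtain ⟨v, rfl⟩ := (Module.AEval'.of N).surjective z
      rw [Module.AEval'.X_pow_smul_of, hm]; simp
    have hk2 : ∀ z, (X : k[X]) ^ m • φ z = 0 := fun z => by rw [← map_smul, hkill, map_zero]
    obtain ⟨z, hz⟩ := φ.surjective (DirectSum.lof k[X] ι (fun i => k[X] ⧸ Submodule.span k[X] {p i ^ e i}) i
      (Submodule.Quotient.mk 1))
    have h3 := hk2 z
    rw [hz, ← map_smul, ← Submodule.Quotient.mk_smul] at h3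
    have h4 := (map_eq_zero_iff _ (DirectSum.of_injective (β := fun i => k[X] ⧸ Submodule.span k[X] {p i ^ e i}) i)).mp h3
    rw [Submodule.Quotient.mk_eq_zero, smul_eq_mul, mul_one] at h4
    have h5 : p i ^ e i ∣ X ^ m := Ideal.mem_span_singleton.mp h4
    have h6 : p i ∣ X := (hp i).prime.dvd_of_dvd_pow ((dvd_pow_self _ h0.ne').trans h5)
    have h7 : Associated (p i) X := (hp i).associated_of_dvd irreducible_X h6
    exact Ideal.span_singleton_eq_span_singleton.mpr h7.pow_pow
  have h1 : HasTriple (k := k) (V := ⨁ i, k[X] ⧸ Submodule.span k[X] {p i ^ e i})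
      (DirectSum.lmap fun i => DistribSMul.toLinearMap k
      (k[X] ⧸ Submodule.span k[X] {p i ^ e i}) (X : k[X])) := by
    apply HasTriple.directSum
    intro i
    rw [hspan i]
    exact hasTriple_quot k (e i)
  refine h1.of_equiv ((φ.restrictScalars k).symm.trans (Module.AEval'.of N).symm) N ?_
  intro v
  have h2 : (DirectSum.lmap fun i => DistribSMul.toLinearMap k
      (k[X] ⧸ Submodule.span k[X] {p i ^ e i}) (X : k[X])) v = (X : k[X]) • v := by
    ext i; rfl
  rw [h2]
  simp only [LinearEquiv.trans_apply]
  have h3 : (φ.restrictScalars k).symm ((X : k[X]) • v) = X • (φ.restrictScalars k).symm v :=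
    φ.symm.map_smul _ _
  rw [h3, Module.AEval'.of_symm_X_smul]

end exist

section tens
variable {k V₁ V₂ : Type*} [Field k] [CharZero k]
    [AddCommGroup V₁] [Module k V₁] [AddCommGroup V₂] [Module k V₂]

/-- The induced operator on the tensor product. -/
noncomputable def tOp (A : V₁ →ₗ[k] V₁) (B : V₂ →ₗ[k] V₂) : V₁ ⊗[k] V₂ →ₗ[k] V₁ ⊗[k] V₂ :=
  LinearMap.rTensor V₂ A + LinearMap.lTensor V₁ B

theorem tOp_tmul (A : V₁ →ₗ[k] V₁) (B : V₂ →ₗ[k] V₂) (x : V₁) (y : V₂) :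
    tOp A B (x ⊗ₜ y) = A x ⊗ₜ y + x ⊗ₜ B y := by
  simp [tOp]

/-- The image of a tensor product of weight spaces. -/
noncomputable def wtT (H₁ : V₁ →ₗ[k] V₁) (H₂ : V₂ →ₗ[k] V₂) (a b : ℤ) :
    Submodule k (V₁ ⊗[k] V₂) :=
  Submodule.map₂ (TensorProduct.mk k V₁ V₂) (Module.End.eigenspace H₁ (a : k))
    (Module.End.eigenspace H₂ (b : k))

theorem wtT_le (H₁ : V₁ →ₗ[k] V₁) (H₂ : V₂ →ₗ[k] V₂) (a b : ℤ) :
    wtT H₁ H₂ a b ≤ Module.End.eigenspace (tOp H₁ H₂) ((a + b : ℤ) : k) := by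
  refine Submodule.map₂_le.mpr fun x hx y hy => ?_
  rw [Module.End.mem_eigenspace_iff] at *
  rw [TensorProduct.mk_apply, tOp_tmul, hx, hy, ← TensorProduct.smul_tmul', TensorProduct.tmul_smul,
    ← add_smul]
  push_cast; rfl

theorem wtT_le_left (H₁ : V₁ →ₗ[k] V₁) (H₂ : V₂ →ₗ[k] V₂) (a b : ℤ) :
    wtT H₁ H₂ a b ≤ Module.End.eigenspace (LinearMap.rTensor V₂ H₁) (a : k) := by
  refine Submodule.map₂_le.mpr fun x hx y hy => ?_
  rw [Module.End.mem_eigenspace_iff] at *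
  rw [TensorProduct.mk_apply, LinearMap.rTensor_tmul, hx, TensorProduct.smul_tmul']

theorem wtT_top (H₁ : V₁ →ₗ[k] V₁) (H₂ : V₂ →ₗ[k] V₂)
    (h₁ : ⨆ l : ℤ, Module.End.eigenspace H₁ (l : k) = ⊤)
    (h₂ : ⨆ l : ℤ, Module.End.eigenspace H₂ (l : k) = ⊤) :
    ⨆ a : ℤ, ⨆ b : ℤ, wtT H₁ H₂ a b = ⊤ := by
  rw [← TensorProduct.map₂_mk_top_top_eq_top, ← h₁, ← h₂, Submodule.map₂_iSup_left]
  simp only [Submodule.map₂_iSup_right, wtT]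

theorem WtTriple.tensor {H₁ X₁ Y₁ : V₁ →ₗ[k] V₁} {H₂ X₂ Y₂ : V₂ →ₗ[k] V₂}
    (h₁ : WtTriple H₁ X₁ Y₁) (h₂ : WtTriple H₂ X₂ Y₂) :
    WtTriple (tOp H₁ H₂) (tOp X₁ X₂) (tOp Y₁ Y₂) where
  hHY v := by
    induction v using TensorProduct.induction_on with
    | zero => simp
    | tmul x y =>
      simp only [tOp_tmul, map_add, h₁.hHY, h₂.hHY, TensorProduct.sub_tmul, TensorProduct.tmul_sub,
        smul_add, TensorProduct.smul_tmul', TensorProduct.tmul_smul]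
      abel
    | add x y hx hy => simp only [map_add, hx, hy, smul_add]; abel
  hHX v := by
    induction v using TensorProduct.induction_on with
    | zero => simp
    | tmul x y =>
      simp only [tOp_tmul, map_add, h₁.hHX, h₂.hHX, TensorProduct.add_tmul, TensorProduct.tmul_add,
        smul_add, TensorProduct.smul_tmul', TensorProduct.tmul_smul]
      abel
    | add x y hx hy => simp only [map_add, hx, hy, smul_add]; abel
  hXY v := by
    induction v using TensorProduct.induction_on with
    | zero => simp
    | tmul x y =>
      simp only [tOp_tmul, map_add, h₁.hXY, h₂.hXY, TensorProduct.add_tmul, TensorProduct.tmul_add]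
      abel
    | add x y hx hy => simp only [map_add, hx, hy]; abel
  top := by
    rw [eq_top_iff, ← wtT_top H₁ H₂ h₁.top h₂.top]
    exact iSup_le fun a => iSup_le fun b => le_iSup_of_le (a + b) (wtT_le _ _ _ _)

theorem eq_of_indep {V : Type*} [AddCommGroup V] [Module k V] {E S : ℤ → Submodule k V}
    (hE : iSupIndep E) (hS : ∀ l, S l ≤ E l) (ht : ⨆ l, S l = ⊤) (i : ℤ) : S i = E i := by
  refine le_antisymm (hS i) fun x hx => ?_
  have h1 : (⊤ : Submodule k V) ≤ S i ⊔ ⨆ l, ⨆ _ : l ≠ i, S l := by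
    rw [← ht]
    refine iSup_le fun l => ?_
    by_cases h : l = i
    · subst h; exact le_sup_left
    · exact le_sup_of_le_right (le_iSup_of_le l (le_iSup_of_le h le_rfl))
  obtain ⟨s, hs, t, ht, hst⟩ := Submodule.mem_sup.mp (h1 (show x ∈ ⊤ from trivial))
  have ht1 : t ∈ E i := by
    rw [show t = x - s by rw [← hst]; abel]
    exact sub_mem hx (hS i hs)
  have ht2 : t ∈ ⨆ l, ⨆ _ : l ≠ i, E l :=
    (iSup_mono fun l => iSup_mono fun _ => hS l : (⨆ l, ⨆ _ : l ≠ i, S l) ≤ _) ht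
  have := Submodule.disjoint_def.mp (hE i) t ht1 ht2
  rw [← hst, this, add_zero]
  exact hs

theorem wt_tensor_eq (H₁ : V₁ →ₗ[k] V₁) (H₂ : V₂ →ₗ[k] V₂)
    (h₁ : ⨆ l : ℤ, Module.End.eigenspace H₁ (l : k) = ⊤)
    (h₂ : ⨆ l : ℤ, Module.End.eigenspace H₂ (l : k) = ⊤) (i : ℤ) :
    ⨆ a : ℤ, wtT H₁ H₂ a (i - a) = Module.End.eigenspace (tOp H₁ H₂) (i : k) := by
  refine eq_of_indep (S := fun i => ⨆ a : ℤ, wtT H₁ H₂ a (i - a)) (wt_indep (tOp H₁ H₂)) ?_ ?_ i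
  · intro l
    refine iSup_le fun a => ?_
    have := wtT_le H₁ H₂ a (l - a)
    rwa [show a + (l - a) = l by ring] at this
  · rw [eq_top_iff, ← wtT_top H₁ H₂ h₁ h₂]
    refine iSup_le fun a => iSup_le fun b => le_iSup_of_le (a + b) (le_iSup_of_le a ?_)
    rw [show a + b - a = b by ring]

theorem fil_tensor_eq (H₁ : V₁ →ₗ[k] V₁) (H₂ : V₂ →ₗ[k] V₂)
    (h₁ : ⨆ l : ℤ, Module.End.eigenspace H₁ (l : k) = ⊤)
    (h₂ : ⨆ l : ℤ, Module.End.eigenspace H₂ (l : k) = ⊤) (i : ℤ) :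
    wtFil (tOp H₁ H₂) i =
      ⨆ i' : ℤ, LinearMap.range (mapIncl (wtFil H₁ i') (wtFil H₂ (i - i'))) := by
  simp only [TensorProduct.range_mapIncl]
  apply le_antisymm
  · refine iSup_le fun l => iSup_le fun hl => ?_
    rw [← wt_tensor_eq H₁ H₂ h₁ h₂]
    refine iSup_le fun a => le_iSup_of_le a ?_
    exact Submodule.map₂_le_map₂ (wt_le_wtFil _ le_rfl) (wt_le_wtFil _ (by omega))
  · refine iSup_le fun a => ?_
    simp only [wtFil, Submodule.map₂_iSup_left, Submodule.map₂_iSup_right]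
    refine iSup_le fun l => iSup_le fun hl => iSup_le fun m => iSup_le fun hm => ?_
    exact le_iSup_of_le (m + l) (le_iSup_of_le (by omega) (wtT_le H₁ H₂ m l))

theorem gr_equiv {V : Type*} [AddCommGroup V] [Module k V] (H : V →ₗ[k] V) (i : ℤ) :
    Nonempty (Module.End.eigenspace H (i : k) ≃ₗ[k] grQ (wtFil H) i) := by
  refine ⟨LinearEquiv.ofBijective
    ((Submodule.mkQ _).comp (Submodule.inclusion (wt_le_wtFil H (le_refl i)))) ⟨?_, ?_⟩⟩
  · rw [injective_iff_map_eq_zero]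
    intro a ha
    have ha' := (Submodule.Quotient.mk_eq_zero _).mp ha
    exact Subtype.ext (Submodule.disjoint_def.mp (wt_disj H i) _ a.2 ha')
  · intro b
    obtain ⟨⟨w, hw⟩, rfl⟩ := Submodule.Quotient.mk_surjective _ b
    have hw' := hw
    rw [wtFil_eq_sup] at hw'
    obtain ⟨e, he, y, hy, rfl⟩ := Submodule.mem_sup.mp hw'
    refine ⟨⟨e, he⟩, ?_⟩
    refine (Submodule.Quotient.eq _).mpr ?_
    change e - (e + y) ∈ wtFil H (i - 1)
    simpa using hy

theorem gr_tensor (H₁ : V₁ →ₗ[k] V₁) (H₂ : V₂ →ₗ[k] V₂)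
    (h₁ : ⨆ l : ℤ, Module.End.eigenspace H₁ (l : k) = ⊤)
    (h₂ : ⨆ l : ℤ, Module.End.eigenspace H₂ (l : k) = ⊤) (i : ℤ) :
    Nonempty (grQ (wtFil (tOp H₁ H₂)) i ≃ₗ[k]
      (⨁ i' : ℤ, ((grQ (wtFil H₁) i') ⊗[k] (grQ (wtFil H₂) (i - i'))))) := by
  classical
  obtain ⟨g⟩ := gr_equiv (tOp H₁ H₂) i
  have g₁ := fun a => (gr_equiv H₁ a).some
  have g₂ := fun a => (gr_equiv H₂ a).some
  let R : ℤ → Submodule k (V₁ ⊗[k] V₂) := fun a => LinearMap.range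
    (mapIncl (Module.End.eigenspace H₁ (a : k)) (Module.End.eigenspace H₂ ((i - a : ℤ) : k)))
  have hR : ∀ a, R a = wtT H₁ H₂ a (i - a) := fun a => TensorProduct.range_mapIncl _ _
  have hind : iSupIndep R := by
    refine (wt_indep (LinearMap.rTensor V₂ H₁)).mono fun a => ?_
    rw [hR]; exact wtT_le_left _ _ _ _
  have hinj : Function.Injective (DirectSum.coeLinearMap R) := hind.dfinsupp_lsum_injective
  have hrange : LinearMap.range (DirectSum.coeLinearMap R) =
      Module.End.eigenspace (tOp H₁ H₂) (i : k) := by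
    rw [DirectSum.range_coeLinearMap, ← wt_tensor_eq H₁ H₂ h₁ h₂]
    exact iSup_congr hR
  let e1 := (LinearEquiv.ofInjective _ hinj).trans (LinearEquiv.ofEq _ _ hrange)
  have e2 : ∀ a : ℤ, (Module.End.eigenspace H₁ (a : k)) ⊗[k]
      (Module.End.eigenspace H₂ ((i - a : ℤ) : k)) ≃ₗ[k] R a := fun a =>
    LinearEquiv.ofInjective _ (TensorProduct.map_injective_of_flat_flat _ _
      (Submodule.subtype_injective _) (Submodule.subtype_injective _))
  have e3 : ∀ a : ℤ, R a ≃ₗ[k] (grQ (wtFil H₁) a) ⊗[k] (grQ (wtFil H₂) (i - a)) := fun a =>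
    (e2 a).symm.trans (TensorProduct.congr (g₁ a) (g₂ (i - a)))
  exact ⟨g.symm.trans (e1.symm.trans (DFinsupp.mapRange.linearEquiv e3))⟩

end tens

/-!
Statement 8: over a field `k` of characteristic zero, the monodromy filtration of
`N = N₁ ⊗ id + id ⊗ N₂` on `V₁ ⊗ V₂` is given by
`M i = Σ_{i'+i''=i} M₁ i' ⊗ M₂ i''`, and consequently
`gr^M_i (V₁ ⊗ V₂) ≅ ⊕_{i'+i''=i} gr_{i'} V₁ ⊗ gr_{i''} V₂`.
-/
theorem stmt_8 {k V₁ V₂ : Type*} [Field k] [CharZero k]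
    [AddCommGroup V₁] [Module k V₁] [FiniteDimensional k V₁]
    [AddCommGroup V₂] [Module k V₂] [FiniteDimensional k V₂]
    (N₁ : V₁ →ₗ[k] V₁) (N₂ : V₂ →ₗ[k] V₂)
    (hN₁ : IsNilpotent N₁) (hN₂ : IsNilpotent N₂)
    (M₁ : ℤ → Submodule k V₁) (hM₁ : IsMonodromyFiltration N₁ M₁)
    (M₂ : ℤ → Submodule k V₂) (hM₂ : IsMonodromyFiltration N₂ M₂)
    (M : ℤ → Submodule k (V₁ ⊗[k] V₂))
    (hM : IsMonodromyFiltration (LinearMap.rTensor V₂ N₁ + LinearMap.lTensor V₁ N₂) M) :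
    (∀ i : ℤ, M i = ⨆ i' : ℤ, LinearMap.range (mapIncl (M₁ i') (M₂ (i - i')))) ∧
    (∀ i : ℤ, Nonempty
      ((grQ M i) ≃ₗ[k] (⨁ i' : ℤ, ((grQ M₁ i') ⊗[k] (grQ M₂ (i - i')))))) := by
  obtain ⟨H₁, X₁, h₁⟩ := hasTriple_of_nilpotent N₁ hN₁
  obtain ⟨H₂, X₂, h₂⟩ := hasTriple_of_nilpotent N₂ hN₂
  obtain rfl := hM₁.unique h₁.isMono
  obtain rfl := hM₂.unique h₂.isMono
  obtain rfl := hM.unique (h₁.tensor h₂).isMono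
  exact ⟨fun i => fil_tensor_eq H₁ H₂ h₁.top h₂.top i,
    fun i => gr_tensor H₁ H₂ h₁.top h₂.top i⟩
end
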